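/- arXiv:1707.07533 — 2 statements merged into one kernel-verified Lean document; each statement's English description precedes it below -/
import Mathlib

section
/- (Symmetrized weak formulation of the nonlinear term, Proposition 1.3.) Let ρ be a bounded positive Radon measure on ℝ² which is absolutely continuous with density in L^p(ℝ²) for some p>2 (and in L¹(ℝ²)). Let E=(x/|x|²)∗ρ. Then for every Φ∈C_c^∞(ℝ²), ∫_{ℝ²}E^⊥(x)·∇Φ(x)ρ(x)dx = H_Φ[ρ,ρ] = (1/2)∬_{ℝ²×ℝ²}H_Φ(x,y)ρ(x)ρ(y)dx dy; equivalently, ⟨∇·(E^⊥ρ),Φ⟩_{D',D} = −H_Φ[ρ,ρ]. -/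
open MeasureTheory Real Filter
open scoped RealInnerProductSpace ENNReal Topology Classical

noncomputable section

/-- The plane `ℝ²`. -/
abbrev E2 : Type := EuclideanSpace ℝ (Fin 2)

/-- The rotation by π/2: `(x₁,x₂)^⊥ = (-x₂,x₁)`. -/
def perp (x : E2) : E2 := !₂[-(x 1), x 0]

/-- The symmetrized kernel `H_Φ`. -/
def Hker (Φ : E2 → ℝ) (x y : E2) : ℝ :=
  if x = y then 0 else ⟪perp (x - y), gradient Φ x - gradient Φ y⟫ / ‖x - y‖ ^ 2

/-- The symmetrized bilinear form `H_Φ[ρ,μ]`. -/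
def Hform (Φ : E2 → ℝ) (ρ μ : Measure E2) : ℝ :=
  (1 / 2) * ∫ x, (∫ y, Hker Φ x y ∂μ) ∂ρ

/-- Entry `(i,j)` of the Jacobian matrix `D∇^⊥Φ` of `∇^⊥Φ = (-∂₂Φ, ∂₁Φ)`. -/
def DperpGrad (Φ : E2 → ℝ) (i j : Fin 2) (x : E2) : ℝ :=
  fderiv ℝ (fun y => perp (gradient Φ y) i) x (EuclideanSpace.single j 1)

/-- Rotation as a continuous linear map. -/
def perpL : E2 →L[ℝ] E2 :=
  LinearMap.toContinuousLinearMap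
    { toFun := perp
      map_add' := by
        intro x y
        ext i
        fin_cases i <;> simp [perp] <;> ring
      map_smul' := by
        intro c x
        ext i
        fin_cases i <;> simp [perp] }

lemma perpL_apply (x : E2) : perpL x = perp x := rfl

lemma norm_perp (x : E2) : ‖perp x‖ = ‖x‖ := by
  simp [EuclideanSpace.norm_eq, perp, Fin.sum_univ_two, add_comm]

/-- The integrable majorant of the singular part of the kernel. -/
def sing (q : ℝ) (z : E2) : ℝ := (Set.Iio (1 : ℝ)).indicator (fun r => r ^ (-q)) ‖z‖

lemma sing_integrable (q : ℝ) (hq : q < 2) : Integrable (sing q) := by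
  unfold sing
  rw [integrable_fun_norm_addHaar (volume : Measure E2)
    (f := (Set.Iio (1 : ℝ)).indicator (fun r => r ^ (-q)))]
  have h : IntegrableOn (fun r : ℝ => r ^ (1 - q)) (Set.Ioo 0 1) := by
    rw [intervalIntegral.integrableOn_Ioo_rpow_iff one_pos]
    linarith
  have h2 := h.integrable_indicator measurableSet_Ioo
  refine (h2.integrableOn (s := Set.Ioi 0)).congr_fun ?_ measurableSet_Ioi
  intro r hr
  have hr : 0 < r := hr
  by_cases h1 : r < 1
  · simp [Set.indicator, h1, hr, sub_eq_add_neg, Real.rpow_add hr]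
  · simp [Set.indicator, h1, hr]

lemma sing_nonneg (q : ℝ) (z : E2) : 0 ≤ sing q z := by
  unfold sing
  refine Set.indicator_apply_nonneg fun _ => ?_
  positivity

lemma key_bound {p q : ℝ} (hpq : p.HolderConjugate q) (a : ℝ) (ha : 0 ≤ a) (z : E2) :
    a * ‖z‖⁻¹ ≤ a + a ^ p + sing q z := by
  have hap : 0 ≤ a ^ p := Real.rpow_nonneg ha p
  by_cases h1 : ‖z‖ < 1
  · have h := Real.young_inequality_of_nonneg ha (inv_nonneg.2 (norm_nonneg z)) hpq
    have e : sing q z = (‖z‖⁻¹) ^ q := by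
      simp [sing, Set.indicator, h1, Real.rpow_neg, Real.inv_rpow]
    rw [e]
    have hz : 0 ≤ (‖z‖⁻¹) ^ q := by positivity
    have := div_le_self hap hpq.lt.le
    have := div_le_self hz hpq.symm.lt.le
    linarith
  · have : ‖z‖⁻¹ ≤ 1 := inv_le_one_of_one_le₀ (not_lt.1 h1)
    have := mul_le_of_le_one_right ha this
    have := sing_nonneg q z
    linarith

lemma norm_kernel (z : E2) : ‖(‖z‖ ^ 2)⁻¹ • z‖ = ‖z‖⁻¹ := by
  rw [norm_smul, norm_inv, norm_pow, norm_norm]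
  by_cases h : ‖z‖ = 0
  · simp [h]
  · field_simp

lemma hker_eq (Φ : E2 → ℝ) (x y : E2) : Hker Φ x y =
    ⟪perp ((‖x - y‖ ^ 2)⁻¹ • (x - y)), gradient Φ x⟫ +
    ⟪perp ((‖y - x‖ ^ 2)⁻¹ • (y - x)), gradient Φ y⟫ := by
  unfold Hker
  split_ifs with h
  · subst h
    simp [← perpL_apply]
  · rw [norm_sub_rev y x, ← neg_sub x y]
    simp only [← perpL_apply, map_smul, map_neg, inner_smul_left, inner_neg_left, inner_sub_right,
      smul_neg, RCLike.conj_to_real]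
    ring

theorem stmt3 (p : ℝ) (hp : 2 < p) (g : E2 → ℝ)
    (hmeas : Measurable g) (hpos : ∀ x, 0 ≤ g x)
    (hL1 : Integrable g) (hLp : MemLp g (ENNReal.ofReal p) volume)
    (Φ : E2 → ℝ) (hΦ : ContDiff ℝ (⊤ : ℕ∞) Φ) (hsupp : HasCompactSupport Φ) :
    (∫ x, ⟪perp (∫ y, g y • ((‖x - y‖ ^ 2)⁻¹ • (x - y))), gradient Φ x⟫ * g x)
        = Hform Φ (volume.withDensity fun x => ENNReal.ofReal (g x))
            (volume.withDensity fun x => ENNReal.ofReal (g x)) ∧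
    Hform Φ (volume.withDensity fun x => ENNReal.ofReal (g x))
        (volume.withDensity fun x => ENNReal.ofReal (g x))
      = (1 / 2) * ∫ x, (∫ y, Hker Φ x y * (g x * g y)) := by
  have hB : Hform Φ (volume.withDensity fun x => ENNReal.ofReal (g x))
        (volume.withDensity fun x => ENNReal.ofReal (g x))
      = (1 / 2) * ∫ x, (∫ y, Hker Φ x y * (g x * g y)) := by
    unfold Hform
    have hm : Measurable fun x => ENNReal.ofReal (g x) := hmeas.ennreal_ofReal
    have ht : ∀ᵐ x ∂(volume : Measure E2), ENNReal.ofReal (g x) < ∞ := by simp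
    simp only [integral_withDensity_eq_integral_toReal_smul hm ht,
      ENNReal.toReal_ofReal (hpos _), smul_eq_mul, ← integral_const_mul]
    congr 3
    ext x
    congr 1
    ext y
    ring
  refine ⟨?_, hB⟩
  rw [hB]
  obtain ⟨q, hpq, hq2⟩ : ∃ q, p.HolderConjugate q ∧ q < 2 := by
    refine ⟨p / (p - 1), Real.HolderConjugate.conjExponent (by linarith), ?_⟩
    rw [div_lt_iff₀] <;> linarith
  have hS := sing_integrable q hq2
  have hgp : Integrable (fun x => g x ^ p) := by
    have := hLp.integrable_norm_rpow (by simp; linarith) (by simp)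
    rw [ENNReal.toReal_ofReal (by linarith)] at this
    simpa [Real.norm_of_nonneg (hpos _)] using this
  have hgrad : Continuous (gradient Φ) := by
    unfold gradient
    exact (LinearIsometryEquiv.continuous _).comp (hΦ.continuous_fderiv (by simp))
  obtain ⟨C, hC⟩ : ∃ C, ∀ x, ‖gradient Φ x‖ ≤ C := by
    have h := (hsupp.fderiv (𝕜 := ℝ)).exists_bound_of_continuous
      (hΦ.continuous_fderiv (by simp))
    obtain ⟨C, hC⟩ := h
    exact ⟨C, fun x => by simpa [gradient] using hC x⟩
  have hC0 : 0 ≤ C := (norm_nonneg _).trans (hC 0)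
  have hperp : Continuous perp := perpL.continuous
  -- integrability of the field at each point
  have hE : ∀ x, Integrable fun y => g y • ((‖x - y‖ ^ 2)⁻¹ • (x - y)) := by
    intro x
    refine Integrable.mono' ((hL1.add hgp).add (hS.comp_sub_left x)) ?_ ?_
    · exact Measurable.aestronglyMeasurable (by fun_prop)
    · refine Eventually.of_forall fun y => ?_
      rw [norm_smul, norm_kernel, Real.norm_of_nonneg (hpos y)]
      exact key_bound hpq _ (hpos y) _
  set F : E2 → E2 → ℝ := fun x y =>
    ⟪perp ((‖x - y‖ ^ 2)⁻¹ • (x - y)), gradient Φ x⟫ * (g x * g y) with hF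
  have hFi : Integrable (Function.uncurry F) (volume.prod volume) := by
    have h1 := hL1.mul_prod (hL1.add hgp)
    have h2 := (hL1.convolution_integrand (ContinuousLinearMap.mul ℝ ℝ) hS.comp_neg).swap
    refine Integrable.mono' ((h1.add h2).const_mul C) ?_ ?_
    · refine Measurable.aestronglyMeasurable ?_
      have hgm := hgrad.measurable
      have hpm := hperp.measurable
      simp only [hF, Function.uncurry_def]
      fun_prop
    · refine Eventually.of_forall fun ⟨x, y⟩ => ?_
      simp only [hF, Function.uncurry, norm_mul, Real.norm_of_nonneg (hpos _), Pi.add_apply,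
        Function.comp, Prod.swap, ContinuousLinearMap.mul_apply', neg_sub]
      have h3 := (norm_inner_le_norm (𝕜 := ℝ) (perp ((‖x - y‖ ^ 2)⁻¹ • (x - y))) (gradient Φ x))
      rw [norm_perp, norm_kernel] at h3
      have hk := key_bound hpq _ (hpos y) (x - y)
      have hx := hpos x
      have hy := hpos y
      calc _ ≤ (‖x - y‖⁻¹ * C) * (g x * g y) := by
            gcongr
            exact h3.trans (by gcongr; exact hC x)
        _ = C * (g x * (g y * ‖x - y‖⁻¹)) := by ring
        _ ≤ C * (g x * (g y + g y ^ p + sing q (x - y))) := by gcongr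
        _ = _ := by ring
  have hL : ∀ x, ⟪perp (∫ y, g y • ((‖x - y‖ ^ 2)⁻¹ • (x - y))), gradient Φ x⟫ * g x
      = ∫ y, F x y := by
    intro x
    rw [← perpL_apply, ← ContinuousLinearMap.integral_comp_comm _ (hE x), real_inner_comm,
      ← integral_inner (perpL.integrable_comp (hE x)), ← integral_mul_const]
    congr 1
    ext y
    simp only [hF, map_smul perpL (g y), inner_smul_right, perpL_apply]
    rw [real_inner_comm]
    ring
  have hH : ∀ x y, Hker Φ x y * (g x * g y) = F x y + F y x := by
    intro x y
    rw [hker_eq]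
    simp only [hF]
    ring
  simp only [hL, hH]
  have hFs : Integrable (Function.uncurry fun x y => F y x) (volume.prod volume) := hFi.swap
  have hadd := integral_integral_add hFi hFs
  have hsw := integral_integral_swap hFi
  simp only [Function.uncurry] at hadd
  rw [hadd, ← hsw]
  ring
end
end

section
/- (Time equicontinuity of the densities, Lemma 2.10, abstract form.) Let T>0, γ>0, C₀>0. For each ε∈(0,1), let ρ_ε:[0,T]→M₊(ℝ²) and ξ_ε:[0,T]→ℝ² satisfy: (i) ρ_ε(t)(B(x₀,r)) ≤ C₀|ln r|^{−1/2} for all t∈[0,T], x₀∈ℝ², 0<r<1/2; (ii) for every Φ∈C_c^∞(ℝ²) and all 0≤s<t≤T, |∫Φdρ_ε(t)+γΦ(ξ_ε(t))−∫Φdρ_ε(s)−γΦ(ξ_ε(s))| ≤ C₀‖Φ‖_{W^{2,∞}}(t−s)+C₀(1+T)ε‖Φ‖_{W^{3,∞}}. Then there exist K₁>0 and ε₀>0 depending only on T, γ and C₀ such that for all 0<ε<ε₀, all 0≤s<t≤T, and every Φ∈C_c^∞(ℝ²) with ‖Φ‖_{W^{3,∞}}≤1: |∫Φdρ_ε(t)−∫Φdρ_ε(s)|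 ≤ K₁((t−s)^{1/2}+ε^{1/3}); that is, ‖ρ_ε(t)−ρ_ε(s)‖_{W^{−3,1}(ℝ²)} ≤ K₁((t−s)^{1/2}+ε^{1/3}). -/
open MeasureTheory Real Filter
open scoped RealInnerProductSpace ENNReal Topology Classical

noncomputable section

/-- `‖Φ‖_{W^{k,∞}}`: the supremum of all derivatives of `Φ` of order `≤ k`. -/
def Wknorm (k : ℕ) (Φ : E2 → ℝ) : ℝ :=
  ⨆ x : E2, ⨆ i : Fin (k + 1), ‖iteratedFDeriv ℝ i Φ x‖

lemma derivs_bounded (Φ : E2 → ℝ) (h1 : ContDiff ℝ (⊤ : ℕ∞) Φ) (h2 : HasCompactSupport Φ)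
    (k : ℕ) : ∃ B : ℝ, 0 < B ∧ ∀ i ≤ k, ∀ x, ‖iteratedFDeriv ℝ i Φ x‖ ≤ B := by
  have h : ∀ i : ℕ, ∃ C, ∀ x, ‖iteratedFDeriv ℝ i Φ x‖ ≤ C := fun i =>
    (h1.continuous_iteratedFDeriv (by exact_mod_cast le_top)).bounded_above_of_compact_support
      (h2.iteratedFDeriv i)
  choose C hC using h
  have hC0 : ∀ i, 0 ≤ C i := fun i => (norm_nonneg _).trans (hC i 0)
  refine ⟨1 + ∑ j ∈ Finset.range (k + 1), C j, ?_, ?_⟩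
  · have := Finset.sum_nonneg (s := Finset.range (k + 1)) (fun i _ => hC0 i)
    linarith
  · intro i hi x
    have h3 : C i ≤ ∑ j ∈ Finset.range (k + 1), C j :=
      Finset.single_le_sum (f := C) (fun i _ => hC0 i) (Finset.mem_range.2 (by omega))
    linarith [hC i x]

lemma Wknorm_le {k : ℕ} {Φ : E2 → ℝ} {B : ℝ}
    (h : ∀ i ≤ k, ∀ x, ‖iteratedFDeriv ℝ i Φ x‖ ≤ B) : Wknorm k Φ ≤ B :=
  ciSup_le fun x => ciSup_le fun i => h i (by omega) x

lemma le_Wknorm {k : ℕ} {Φ : E2 → ℝ} (h1 : ContDiff ℝ (⊤ : ℕ∞) Φ) (h2 : HasCompactSupport Φ)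
    {i : ℕ} (hi : i ≤ k) (x : E2) : ‖iteratedFDeriv ℝ i Φ x‖ ≤ Wknorm k Φ := by
  obtain ⟨B, hB, h⟩ := derivs_bounded Φ h1 h2 k
  have hb : BddAbove (Set.range fun x : E2 => ⨆ i : Fin (k + 1), ‖iteratedFDeriv ℝ i Φ x‖) := by
    refine ⟨B, ?_⟩
    rintro _ ⟨y, rfl⟩
    exact ciSup_le fun i => h i (by omega) y
  refine le_trans ?_ (le_ciSup hb x)
  exact le_ciSup (f := fun j : Fin (k + 1) => ‖iteratedFDeriv ℝ (j : ℕ) Φ x‖)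
    (Set.finite_range _).bddAbove ⟨i, by omega⟩

lemma scaled_bound {f : E2 → ℝ} (hf : ContDiff ℝ (⊤ : ℕ∞) f) {B : ℝ} {k : ℕ} (hB : 0 < B)
    (h : ∀ i ≤ k, ∀ x, ‖iteratedFDeriv ℝ i f x‖ ≤ B) {R : ℝ} (hR : 0 < R) (hR1 : R ≤ 1) (a : E2) :
    Wknorm k (fun x => f (R⁻¹ • (x - a))) ≤ B / R ^ k := by
  apply Wknorm_le
  intro i hi x
  have e1 : iteratedFDeriv ℝ i (fun x => f (R⁻¹ • (x - a))) x
      = iteratedFDeriv ℝ i (f ∘ (R⁻¹ • ContinuousLinearMap.id ℝ E2)) (x - a) :=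
    iteratedFDeriv_comp_sub (f := f ∘ (R⁻¹ • ContinuousLinearMap.id ℝ E2)) i a x
  rw [e1, ContinuousLinearMap.iteratedFDeriv_comp_right _ hf _ (by exact_mod_cast le_top)]
  refine (ContinuousMultilinearMap.norm_compContinuousLinearMap_le _ _).trans ?_
  have hn : ‖R⁻¹ • ContinuousLinearMap.id ℝ E2‖ ≤ R⁻¹ := by
    rw [norm_smul, Real.norm_of_nonneg (by positivity)]
    exact mul_le_of_le_one_right (by positivity) ContinuousLinearMap.norm_id_le
  have hR2 : 1 ≤ R⁻¹ := (one_le_inv₀ hR).2 hR1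
  rw [Finset.prod_const, Finset.card_univ, Fintype.card_fin, div_eq_mul_inv, ← inv_pow]
  gcongr
  · exact h i hi _
  · exact (pow_le_pow_left₀ (norm_nonneg _) hn i).trans (pow_le_pow_right₀ hR2 hi)

lemma close_points (T γ C₀ : ℝ) (hT : 0 < T) (hγ : 0 < γ) (hC₀ : 0 < C₀) :
    ∃ M R₀ : ℝ, 0 < M ∧ 0 < R₀ ∧ ∀ (μ ν : Measure E2) (a b : E2) (δ ε h : ℝ),
      IsFiniteMeasure μ → IsFiniteMeasure ν →
      (∀ x₀ : E2, ∀ r : ℝ, 0 < r → r < 1 / 2 →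
          (ν (Metric.ball x₀ r)).toReal ≤ C₀ * |Real.log r| ^ (-(1 / 2 : ℝ))) →
      (∀ Φ : E2 → ℝ, ContDiff ℝ (⊤ : ℕ∞) Φ → HasCompactSupport Φ →
          |(∫ x, Φ x ∂μ) + γ * Φ a - (∫ x, Φ x ∂ν) - γ * Φ b| ≤
            C₀ * Wknorm 2 Φ * δ + C₀ * (1 + T) * ε * Wknorm 3 Φ) →
      0 ≤ δ → 0 ≤ ε → 0 < h → δ ≤ h ^ 2 → ε ≤ h ^ 3 → M * h ≤ R₀ → dist a b ≤ M * h := by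
  let f : ContDiffBump (0 : E2) := ⟨1 / 2, 1, by norm_num, by norm_num⟩
  have hf : ContDiff ℝ (⊤ : ℕ∞) f := f.contDiff
  obtain ⟨B, hB, hBf⟩ := derivs_bounded f hf f.hasCompactSupport 3
  set A : ℝ := 4 * C₀ / γ with hA
  have hA0 : 0 < A := by positivity
  refine ⟨1 + 4 * (C₀ * B * (2 + T)) / γ, min (1 / 4) (Real.exp (-(A ^ 2))), by positivity,
    by positivity, ?_⟩
  set M : ℝ := 1 + 4 * (C₀ * B * (2 + T)) / γ with hM
  have hM1 : 1 ≤ M := by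
    have : 0 < 4 * (C₀ * B * (2 + T)) / γ := by positivity
    linarith
  have hM2 : C₀ * B * (2 + T) / M ≤ γ / 4 := by
    rw [div_le_iff₀ (by positivity), hM]
    have : γ / 4 * (1 + 4 * (C₀ * B * (2 + T)) / γ) = γ / 4 + C₀ * B * (2 + T) := by
      field_simp
    rw [this]; linarith
  intro μ ν a b δ ε h _ _ hball hweak hδ hε hh hδh hεh hMh
  by_contra! hd
  set R : ℝ := M * h with hR
  have hR0 : 0 < R := by positivity
  have hR4 : R ≤ 1 / 4 := hMh.trans (min_le_left _ _)
  have hRe : R ≤ Real.exp (-(A ^ 2)) := hMh.trans (min_le_right _ _)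
  have hlog : A ^ 2 ≤ |Real.log R| := by
    have h1 : Real.log R ≤ -(A ^ 2) := (Real.log_le_iff_le_exp hR0).2 hRe
    linarith [neg_le_abs (Real.log R)]
  have hlog2 : C₀ * |Real.log R| ^ (-(1 / 2 : ℝ)) ≤ γ / 4 := by
    have h1 : |Real.log R| ^ (-(1 / 2 : ℝ)) ≤ (A ^ 2) ^ (-(1 / 2 : ℝ)) :=
      Real.rpow_le_rpow_of_nonpos (by positivity) hlog (by norm_num)
    have h2 : (A ^ 2) ^ (-(1 / 2 : ℝ)) = A⁻¹ := by
      rw [← Real.rpow_natCast, ← Real.rpow_mul hA0.le, ← Real.rpow_neg_one]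
      norm_num
    rw [h2] at h1
    calc _ ≤ C₀ * A⁻¹ := by gcongr
      _ = γ / 4 := by rw [hA]; field_simp
  let g : E2 → ℝ := fun x => f (R⁻¹ • (x - a))
  have hg : ContDiff ℝ (⊤ : ℕ∞) g := by
    apply hf.comp
    fun_prop
  have hg0 : ∀ x, R ≤ dist x a → g x = 0 := by
    intro x hx
    apply f.zero_of_le_dist
    rw [dist_zero_right, norm_smul, Real.norm_of_nonneg (by positivity), ← dist_eq_norm]
    change (1 : ℝ) ≤ _
    rw [inv_mul_eq_div, le_div_iff₀ hR0]
    linarith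
  have hgc : HasCompactSupport g := by
    apply HasCompactSupport.intro (isCompact_closedBall a R)
    intro x hx
    apply hg0
    rw [Metric.mem_closedBall, not_le] at hx
    exact hx.le
  have hga : g a = 1 := by
    apply f.one_of_mem_closedBall
    simp [f]
  have hgb : g b = 0 := hg0 b (by rw [dist_comm]; exact hd.le)
  have hmu_int : 0 ≤ ∫ x, g x ∂μ := integral_nonneg fun x => f.nonneg
  have hnu_int : ∫ x, g x ∂ν ≤ γ / 4 := by
    calc ∫ x, g x ∂ν ≤ ∫ x, (Metric.ball a R).indicator (fun _ => (1 : ℝ)) x ∂ν := by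
          apply integral_mono
          · exact hg.continuous.integrable_of_hasCompactSupport hgc
          · exact (integrable_const _).indicator measurableSet_ball
          · intro x
            by_cases hx : x ∈ Metric.ball a R
            · simp only [Set.indicator_of_mem hx]; exact f.le_one
            · simp only [Set.indicator_of_notMem hx]
              rw [Metric.mem_ball, not_lt] at hx
              exact (hg0 x hx).le
      _ = (ν (Metric.ball a R)).toReal := by
          rw [integral_indicator measurableSet_ball]; simp [Measure.real]
      _ ≤ _ := (hball a R hR0 (by linarith)).trans hlog2
  have hw := (le_abs_self _).trans (hweak g hg hgc)
  rw [hga, hgb] at hw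
  have w2 : Wknorm 2 g ≤ B / R ^ 2 :=
    scaled_bound hf hB (fun i hi => hBf i (by omega)) hR0 (by linarith) a
  have w3 : Wknorm 3 g ≤ B / R ^ 3 :=
    scaled_bound hf hB (fun i hi => hBf i (by omega)) hR0 (by linarith) a
  have t2 : C₀ * Wknorm 2 g * δ ≤ C₀ * B / M := by
    calc C₀ * Wknorm 2 g * δ ≤ C₀ * (B / R ^ 2) * h ^ 2 := by gcongr
      _ = C₀ * B / M ^ 2 := by rw [hR]; field_simp
      _ ≤ C₀ * B / M := by gcongr; nlinarith
  have w0 : 0 ≤ Wknorm 3 g := (norm_nonneg _).trans (le_Wknorm hg hgc (Nat.zero_le 3) a)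
  have t3 : C₀ * (1 + T) * ε * Wknorm 3 g ≤ C₀ * (1 + T) * B / M := by
    calc C₀ * (1 + T) * ε * Wknorm 3 g ≤ C₀ * (1 + T) * h ^ 3 * (B / R ^ 3) := by gcongr
      _ = C₀ * (1 + T) * B / M ^ 3 := by rw [hR]; field_simp
      _ ≤ C₀ * (1 + T) * B / M := by
          gcongr
          exact le_self_pow₀ hM1 (by norm_num)
  have t4 : C₀ * B / M + C₀ * (1 + T) * B / M = C₀ * B * (2 + T) / M := by ring
  linarith

/-- **Lemma 2.10 (time equicontinuity of the densities, abstract form).** Under the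
non-concentration bound (i) and the weak equicontinuity bound (ii), there are `K₁ > 0` and
`ε₀ > 0` depending only on `T`, `γ`, `C₀` such that
`‖ρ_ε(t) - ρ_ε(s)‖_{W^{-3,1}} ≤ K₁((t-s)^{1/2} + ε^{1/3})`, the `W^{-3,1}` norm being expressed
by duality against test functions `Φ` with `‖Φ‖_{W^{3,∞}} ≤ 1`. -/
theorem stmt8 (T γ C₀ : ℝ) (hT : 0 < T) (hγ : 0 < γ) (hC₀ : 0 < C₀) :
    ∃ K₁ : ℝ, 0 < K₁ ∧ ∃ ε₀ : ℝ, 0 < ε₀ ∧ ε₀ ≤ 1 ∧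
      ∀ (ρ : ℝ → ℝ → Measure E2) (ξ : ℝ → ℝ → E2),
        (∀ ε, ε ∈ Set.Ioo (0 : ℝ) 1 → ∀ t ∈ Set.Icc 0 T, IsFiniteMeasure (ρ ε t)) →
        (∀ ε, ε ∈ Set.Ioo (0 : ℝ) 1 → ∀ t ∈ Set.Icc 0 T, ∀ x₀ : E2, ∀ r : ℝ,
          0 < r → r < 1 / 2 →
          ((ρ ε t) (Metric.ball x₀ r)).toReal ≤ C₀ * |Real.log r| ^ (-(1 / 2 : ℝ))) →
        (∀ ε, ε ∈ Set.Ioo (0 : ℝ) 1 → ∀ Φ : E2 → ℝ, ContDiff ℝ (⊤ : ℕ∞) Φ → HasCompactSupport Φ →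
          ∀ s t : ℝ, 0 ≤ s → s < t → t ≤ T →
          |(∫ x, Φ x ∂(ρ ε t)) + γ * Φ (ξ ε t) - (∫ x, Φ x ∂(ρ ε s)) - γ * Φ (ξ ε s)| ≤
            C₀ * Wknorm 2 Φ * (t - s) + C₀ * (1 + T) * ε * Wknorm 3 Φ) →
        ∀ ε, 0 < ε → ε < ε₀ → ∀ s t : ℝ, 0 ≤ s → s < t → t ≤ T →
          ∀ Φ : E2 → ℝ, ContDiff ℝ (⊤ : ℕ∞) Φ → HasCompactSupport Φ → Wknorm 3 Φ ≤ 1 →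
            |(∫ x, Φ x ∂(ρ ε t)) - (∫ x, Φ x ∂(ρ ε s))| ≤
              K₁ * ((t - s) ^ ((1 : ℝ) / 2) + ε ^ ((1 : ℝ) / 3)) := by
  obtain ⟨M, R₀, hM, hR₀, hclose⟩ := close_points T γ C₀ hT hγ hC₀
  set D : ℝ := C₀ * T + C₀ * (1 + T) + 2 * γ with hD
  have hD0 : 0 < D := by positivity
  refine ⟨D * M / R₀ + (C₀ * √T + C₀ * (1 + T) + γ * M), by positivity, 1, one_pos, le_rfl, ?_⟩
  intro ρ ξ hfin hball hweak ε hε0 hε1 s t hs hst htT Φ hΦ hΦc hW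
  have hε : ε ∈ Set.Ioo (0 : ℝ) 1 := ⟨hε0, hε1⟩
  have hδ : 0 < t - s := by linarith
  set p : ℝ := (t - s) ^ ((1 : ℝ) / 2) with hp
  set q : ℝ := ε ^ ((1 : ℝ) / 3) with hq
  have hp0 : 0 < p := Real.rpow_pos_of_pos hδ _
  have hq0 : 0 < q := Real.rpow_pos_of_pos hε0 _
  have hp2 : p ^ 2 = t - s := by
    rw [hp, ← Real.rpow_natCast, ← Real.rpow_mul hδ.le]; norm_num
  have hq3 : q ^ 3 = ε := by
    rw [hq, ← Real.rpow_natCast, ← Real.rpow_mul hε0.le]; norm_num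
  have hq1 : q ≤ 1 := Real.rpow_le_one hε0.le hε1.le (by norm_num)
  have hεq : ε ≤ q := by rw [← hq3]; exact pow_le_of_le_one hq0.le hq1 (by norm_num)
  have hpT : p ≤ √T := Real.le_sqrt_of_sq_le (by rw [hp2]; linarith)
  have hw := abs_le.1 (hweak ε hε Φ hΦ hΦc s t hs hst htT)
  have hder : ∀ i ≤ 3, ∀ x, ‖iteratedFDeriv ℝ i Φ x‖ ≤ 1 := fun i hi x =>
    (le_Wknorm hΦ hΦc hi x).trans hW
  have hW2 : Wknorm 2 Φ ≤ 1 := Wknorm_le fun i hi => hder i (by omega)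
  have hΦ1 : ∀ x, |Φ x| ≤ 1 := fun x => by
    have := hder 0 (by norm_num) x
    rwa [norm_iteratedFDeriv_zero] at this
  have hLip : ∀ x y, |Φ x - Φ y| ≤ dist x y := fun x y => by
    have h := Convex.norm_image_sub_le_of_norm_fderiv_le (𝕜 := ℝ) (f := Φ) (C := 1)
      (s := Set.univ) (x := y) (y := x) (fun z _ => (hΦ.differentiable (by simp)) z)
      (fun z _ => by rw [← norm_iteratedFDeriv_one]; exact hder 1 (by norm_num) z)
      convex_univ (Set.mem_univ _) (Set.mem_univ _)
    rwa [one_mul, ← dist_eq_norm] at h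
  have e2 : C₀ * Wknorm 2 Φ * (t - s) ≤ C₀ * (t - s) := by
    have : C₀ * Wknorm 2 Φ ≤ C₀ * 1 := by gcongr
    nlinarith
  have e3 : C₀ * (1 + T) * ε * Wknorm 3 Φ ≤ C₀ * (1 + T) * ε :=
    mul_le_of_le_one_right (by positivity) hW
  by_cases hsmall : M * (p + q) ≤ R₀
  · have hd : dist (ξ ε t) (ξ ε s) ≤ M * (p + q) := by
      refine hclose (ρ ε t) (ρ ε s) (ξ ε t) (ξ ε s) (t - s) ε (p + q)
        (hfin ε hε t ⟨by linarith, htT⟩) (hfin ε hε s ⟨hs, by linarith⟩)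
        (hball ε hε s ⟨hs, by linarith⟩)
        (fun Ψ h1 h2 => hweak ε hε Ψ h1 h2 s t hs hst htT) hδ.le hε0.le (by positivity) ?_ ?_ hsmall
      · rw [← hp2]; gcongr; linarith
      · nth_rewrite 1 [← hq3]; gcongr; linarith
    have hL := abs_le.1 ((hLip (ξ ε t) (ξ ε s)).trans hd)
    have g1 : γ * (Φ (ξ ε t) - Φ (ξ ε s)) ≤ γ * (M * (p + q)) := by gcongr; exact hL.2
    have g2 : γ * -(M * (p + q)) ≤ γ * (Φ (ξ ε t) - Φ (ξ ε s)) := by gcongr; exact hL.1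
    have f1 : C₀ * (t - s) ≤ C₀ * √T * (p + q) := by
      rw [← hp2, mul_assoc]
      gcongr
      nlinarith [Real.sqrt_nonneg T]
    have f2 : C₀ * (1 + T) * ε ≤ C₀ * (1 + T) * (p + q) := by gcongr; linarith
    have f3 : 0 ≤ D * M / R₀ * (p + q) := by positivity
    have key : (D * M / R₀ + (C₀ * √T + C₀ * (1 + T) + γ * M)) * (p + q) = D * M / R₀ * (p + q) +
        (C₀ * √T * (p + q) + C₀ * (1 + T) * (p + q) + γ * (M * (p + q))) := by ring
    rw [abs_le, key]
    constructor <;> linarith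
  · push Not at hsmall
    have f1 : D ≤ D * M / R₀ * (p + q) := by
      have : D * M / R₀ * (p + q) = D * (M * (p + q) / R₀) := by ring
      rw [this]
      exact le_mul_of_one_le_right hD0.le ((one_le_div hR₀).2 hsmall.le)
    have f2 : 0 ≤ (C₀ * √T + C₀ * (1 + T) + γ * M) * (p + q) := by positivity
    have f3 : C₀ * (t - s) ≤ C₀ * T := by gcongr; linarith
    have f4 : C₀ * (1 + T) * ε ≤ C₀ * (1 + T) := mul_le_of_le_one_right (by positivity) hε1.le
    have a1 := abs_le.1 (hΦ1 (ξ ε t))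
    have a2 := abs_le.1 (hΦ1 (ξ ε s))
    have g1 : γ * (Φ (ξ ε t) - Φ (ξ ε s)) ≤ γ * 2 := by gcongr; linarith
    have g2 : γ * (-2) ≤ γ * (Φ (ξ ε t) - Φ (ξ ε s)) := by gcongr; linarith
    rw [abs_le, add_mul]
    constructor <;> linarith
end
end
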